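/- Let (Ω, ℱ, P) be a probability space and X : Ω → ℝ a nonnegative random variable with E[X²] < ∞ whose law has a support containing at least three points, and define D(m₁, m₂) := E[min(X², (X − m₁)², (X − m₂)²)]. Then the infimum of D over the set {(m₁, m₂) ∈ ℝ² : 0 ≤ m₁ ≤ m₂} is attained, and it can be attained at a point (m₁, m₂) with 0 < m₁ < m₂; i.e. the constrained three-point quantization problem with one knot fixed at zero admits an optimal magnitude pair with two distinct strictly positive magnitudes. -/

import Mathlib

open MeasureTheory

/-- The expected squared error of quantizing `X` with the knots `0`, `a` and `b`. -/
noncomputable def threePointDistortion {Ω : Type*} [MeasurableSpace Ω] (P : Measure Ω)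
    (X : Ω → ℝ) (a b : ℝ) : ℝ :=
  ∫ ω, min ((X ω) ^ 2) (min ((X ω - a) ^ 2) ((X ω - b) ^ 2)) ∂P

/-- The map `s ↦ s / (1 - s)` identifies `[0, 1)` with `[0, ∞)`; at `s = 1` the convention
`1 / 0 = 0` provides the correct limit `x ^ 2`, since a knot beyond `2 * x` is inactive. -/
theorem continuousOn_min_sq_sub_div_one_sub {x : ℝ} (hx : 0 ≤ x) :
    ContinuousOn (fun s : ℝ => min (x ^ 2) ((x - s / (1 - s)) ^ 2)) (Set.Icc 0 1) := by
  intro s hs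
  rcases hs.2.lt_or_eq with h | rfl
  · have h1 : 1 - s ≠ 0 := by linarith
    apply ContinuousAt.continuousWithinAt
    fun_prop (disch := assumption)
  · have hlt : 2 * x / (1 + 2 * x) < 1 := by
      rw [div_lt_one (by positivity)]
      linarith
    have hev : ∀ᶠ t in nhdsWithin (1 : ℝ) (Set.Icc 0 1),
        min (x ^ 2) ((x - t / (1 - t)) ^ 2) = x ^ 2 := by
      filter_upwards [self_mem_nhdsWithin, mem_nhdsWithin_of_mem_nhds (lt_mem_nhds hlt)]
        with t ht ht2
      rw [min_eq_left]
      rcases ht.2.lt_or_eq with h | rfl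
      · have h2 : 2 * x ≤ t / (1 - t) := by
          rw [div_lt_iff₀ (by positivity)] at ht2
          rw [le_div_iff₀ (by linarith)]
          linarith
        nlinarith
      · simp
    refine (continuousWithinAt_const (b := x ^ 2)).congr_of_eventuallyEq hev ?_
    simp

section

variable {Ω : Type*} [MeasurableSpace Ω] {P : Measure Ω} {X : Ω → ℝ}

theorem threePointDistortion_comm (a b : ℝ) :
    threePointDistortion P X a b = threePointDistortion P X b a := by
  simp only [threePointDistortion, min_comm ((_ - a) ^ 2)]

theorem threePointDistortion_zero_left (b : ℝ) :
    threePointDistortion P X 0 b = threePointDistortion P X b b := by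
  simp [threePointDistortion]

theorem integrable_min_sq (hX : Measurable X) (hX2 : Integrable (fun ω => (X ω) ^ 2) P)
    (a b : ℝ) :
    Integrable (fun ω => min ((X ω) ^ 2) (min ((X ω - a) ^ 2) ((X ω - b) ^ 2))) P := by
  refine hX2.mono' (by fun_prop) (Filter.Eventually.of_forall fun ω => ?_)
  rw [Real.norm_of_nonneg (by positivity)]
  exact min_le_left _ _

theorem integral_lt_integral_of_le_of_measure_lt_pos {f g : Ω → ℝ} (hf : Integrable f P)
    (hg : Integrable g P) (hle : f ≤ g) (hlt : 0 < P {ω | f ω < g ω}) :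
    ∫ ω, f ω ∂P < ∫ ω, g ω ∂P := by
  rw [← sub_pos, ← integral_sub hg hf,
    integral_pos_iff_support_of_nonneg (fun ω => sub_nonneg.2 (hle ω)) (hg.sub hf)]
  exact hlt.trans_le (measure_mono fun ω hω => sub_ne_zero.2 (ne_of_gt hω))

/-- Adding a knot at a positive point of the support strictly decreases the distortion. -/
theorem threePointDistortion_lt_self (hX : Measurable X)
    (hX2 : Integrable (fun ω => (X ω) ^ 2) P) {a s : ℝ} (hs : 0 < s) (hsa : s ≠ a)
    (hsupp : ∀ ε : ℝ, 0 < ε → 0 < P {ω | |X ω - s| < ε}) :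
    threePointDistortion P X a s < threePointDistortion P X a a := by
  refine integral_lt_integral_of_le_of_measure_lt_pos
    (integrable_min_sq hX hX2 a s) (integrable_min_sq hX hX2 a a)
    (fun ω => ?_) ?_
  · simp only [min_self]
    exact min_le_min_left _ (min_le_left _ _)
  · have hd : 0 < |s - a| := abs_pos.2 (sub_ne_zero.2 hsa)
    refine (hsupp (min s |s - a| / 2) (by positivity)).trans_le (measure_mono ?_)
    intro ω hω
    simp only [Set.mem_ofPred_eq, min_self] at hω ⊢
    have h1 := min_le_left s |s - a|
    have h2 := min_le_right s |s - a|
    have h3 : |s - a| ≤ |X ω - s| + |X ω - a| := by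
      rw [abs_sub_comm (X ω) s]
      exact abs_sub_le _ _ _
    have h4 : s ≤ |X ω - s| + |X ω| := by
      have := neg_abs_le (X ω - s)
      have := le_abs_self (X ω)
      linarith
    refine (min_le_right _ _).trans_lt ((min_le_right _ _).trans_lt (lt_min ?_ ?_))
    · exact sq_lt_sq.2 (by linarith)
    · exact sq_lt_sq.2 (by linarith)

theorem exists_forall_threePointDistortion_le (hX : Measurable X) (hX0 : ∀ ω, 0 ≤ X ω)
    (hX2 : Integrable (fun ω => (X ω) ^ 2) P) :
    ∃ m₁ m₂ : ℝ, 0 ≤ m₁ ∧ 0 ≤ m₂ ∧ ∀ a b : ℝ, 0 ≤ a → 0 ≤ b →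
      threePointDistortion P X m₁ m₂ ≤ threePointDistortion P X a b := by
  have hcont : ContinuousOn (fun p : ℝ × ℝ =>
      threePointDistortion P X (p.1 / (1 - p.1)) (p.2 / (1 - p.2)))
      (Set.Icc 0 1 ×ˢ Set.Icc 0 1) := by
    refine continuousOn_of_dominated (bound := fun ω => (X ω) ^ 2)
      (fun p _ => (integrable_min_sq hX hX2 _ _).aestronglyMeasurable)
      (fun p _ => Filter.Eventually.of_forall fun ω => ?_) hX2
      (Filter.Eventually.of_forall fun ω => ?_)
    · rw [Real.norm_of_nonneg (by positivity)]
      exact min_le_left _ _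
    · have hk := continuousOn_min_sq_sub_div_one_sub (hX0 ω)
      have h1 := hk.comp (continuousOn_fst (s := Set.Icc (0 : ℝ) 1 ×ˢ Set.Icc (0 : ℝ) 1))
        fun p hp => hp.1
      have h2 := hk.comp (continuousOn_snd (s := Set.Icc (0 : ℝ) 1 ×ˢ Set.Icc (0 : ℝ) 1))
        fun p hp => hp.2
      refine (ContinuousOn.inf h1 h2).congr fun p _ => ?_
      exact inf_inf_distrib_left _ _ _
  obtain ⟨p, hp, hmin⟩ := (isCompact_Icc.prod isCompact_Icc).exists_isMinOn
    ⟨((0 : ℝ), (0 : ℝ)), by simp⟩ hcont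
  refine ⟨p.1 / (1 - p.1), p.2 / (1 - p.2), div_nonneg hp.1.1 (sub_nonneg.2 hp.1.2),
    div_nonneg hp.2.1 (sub_nonneg.2 hp.2.2), fun a b ha hb => ?_⟩
  have hmem : ∀ c : ℝ, 0 ≤ c → c / (1 + c) ∈ Set.Icc (0 : ℝ) 1 := fun c hc =>
    ⟨by positivity, (div_le_one (by positivity)).2 (by linarith)⟩
  have hinv : ∀ c : ℝ, 0 ≤ c → c / (1 + c) / (1 - c / (1 + c)) = c := fun c hc => by
    have : 1 + c ≠ 0 := by positivity
    have h : 1 - c / (1 + c) = (1 + c)⁻¹ := by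
      field_simp
      ring
    rw [h]
    field_simp
  have h := isMinOn_iff.1 hmin (a / (1 + a), b / (1 + b)) ⟨hmem a ha, hmem b hb⟩
  simpa only [hinv a ha, hinv b hb] using h

theorem nonneg_of_forall_measure_abs_sub_lt_pos (hX0 : ∀ ω, 0 ≤ X ω) {s : ℝ}
    (hsupp : ∀ ε : ℝ, 0 < ε → 0 < P {ω | |X ω - s| < ε}) : 0 ≤ s := by
  by_contra! hs
  obtain ⟨ω, hω⟩ := nonempty_of_measure_ne_zero (hsupp (-s) (by linarith)).ne'
  rw [Set.mem_ofPred_eq] at hω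
  have h1 := (abs_lt.1 hω).2
  linarith [hX0 ω]

end

/-- If the support of the law of `X` contains at least three points (expressed
by the existence of three distinct reals whose every neighborhood is charged by
the law of `X`), then the constrained three-point quantization problem with one
knot fixed at zero admits an optimal magnitude pair: the infimum of
`D (m₁, m₂) = E[min (X², (X - m₁)², (X - m₂)²)]` over `{0 ≤ m₁ ≤ m₂}` is
attained at a point with `0 < m₁ < m₂`. -/
theorem stmt17 {Ω : Type*} [MeasurableSpace Ω] (P : Measure Ω) [IsProbabilityMeasure P]
    (X : Ω → ℝ) (hXmeas : Measurable X) (hXnonneg : ∀ ω, 0 ≤ X ω)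
    (hX2 : Integrable (fun ω => (X ω) ^ 2) P)
    (hsupp : ∃ a b c : ℝ, a ≠ b ∧ a ≠ c ∧ b ≠ c ∧
      (∀ ε : ℝ, 0 < ε → 0 < P {ω | |X ω - a| < ε}) ∧
      (∀ ε : ℝ, 0 < ε → 0 < P {ω | |X ω - b| < ε}) ∧
      (∀ ε : ℝ, 0 < ε → 0 < P {ω | |X ω - c| < ε})) :
    ∃ m₁ m₂ : ℝ, 0 < m₁ ∧ m₁ < m₂ ∧
      ∀ a b : ℝ, 0 ≤ a → a ≤ b →
        (∫ ω, min ((X ω) ^ 2) (min ((X ω - m₁) ^ 2) ((X ω - m₂) ^ 2)) ∂P) ≤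
          ∫ ω, min ((X ω) ^ 2) (min ((X ω - a) ^ 2) ((X ω - b) ^ 2)) ∂P := by
  have hne : ∀ m : ℝ, ∃ s : ℝ, 0 < s ∧ s ≠ m ∧
      ∀ ε : ℝ, 0 < ε → 0 < P {ω | |X ω - s| < ε} := by
    obtain ⟨a, b, c, hab, hac, hbc, ha, hb, hc⟩ := hsupp
    have ha0 := nonneg_of_forall_measure_abs_sub_lt_pos hXnonneg ha
    have hb0 := nonneg_of_forall_measure_abs_sub_lt_pos hXnonneg hb
    have hc0 := nonneg_of_forall_measure_abs_sub_lt_pos hXnonneg hc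
    intro m
    by_cases h1 : 0 < a ∧ a ≠ m
    · exact ⟨a, h1.1, h1.2, ha⟩
    by_cases h2 : 0 < b ∧ b ≠ m
    · exact ⟨b, h2.1, h2.2, hb⟩
    exact ⟨c, by grind, by grind, hc⟩
  obtain ⟨m₁, m₂, h1, h2, hmin⟩ :=
    exists_forall_threePointDistortion_le (P := P) hXmeas hXnonneg hX2
  have hdiag : ∀ m : ℝ, 0 ≤ m →
      threePointDistortion P X m₁ m₂ < threePointDistortion P X m m := fun m hm => by
    obtain ⟨s, hs, hsm, hsP⟩ := hne m
    exact (hmin m s hm hs.le).trans_lt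
      (threePointDistortion_lt_self hXmeas hX2 hs hsm hsP)
  have h1' : 0 < m₁ := h1.lt_of_ne fun h => by
    subst h
    exact (hdiag m₂ h2).ne (threePointDistortion_zero_left m₂)
  have h2' : 0 < m₂ := h2.lt_of_ne fun h => by
    subst h
    exact (hdiag m₁ h1).ne
      ((threePointDistortion_comm _ _).trans (threePointDistortion_zero_left m₁))
  have h12 : m₁ ≠ m₂ := fun h => by
    subst h
    exact (hdiag m₁ h1).ne rfl
  rcases h12.lt_or_gt with h | h
  · exact ⟨m₁, m₂, h1', h, fun a b ha hab => hmin a b ha (ha.trans hab)⟩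
  · exact ⟨m₂, m₁, h2', h, fun a b ha hab =>
      (threePointDistortion_comm m₂ m₁).trans_le (hmin a b ha (ha.trans hab))⟩
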